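/- arXiv:2009.02783 — 2 statements merged into one kernel-verified Lean document; each statement's English description precedes it below -/
import Mathlib

section
/- Let H = (X,Y,E) be a complete bipartite r-uniform hypergraph with |X| = |Y| = r and r ≥ 2, in which every vertex has the same degree δ (the degree of a vertex is the number of hyperedges containing it). Then the edge-domatic number of H equals δ, i.e., ed(H) = δ; in particular |E| = 2δ. -/
open Finset

/-- Two vertices of a hypergraph with edge set `E` are adjacent if they are distinct
and some hyperedge contains both of them. -/
def HypVAdj {V : Type*} (E : Finset (Finset V)) (x y : V) : Prop :=
  x ≠ y ∧ ∃ e ∈ E, x ∈ e ∧ y ∈ e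

/-- A dominating set: every vertex outside `D` is adjacent to some vertex of `D`. -/
def IsDominatingSet {V : Type*} (E : Finset (Finset V)) (D : Finset V) : Prop :=
  ∀ x : V, x ∉ D → ∃ y ∈ D, HypVAdj E x y

/-- A total dominating set: every vertex is adjacent to some vertex of `D`. -/
def IsTotalDominatingSet {V : Type*} (E : Finset (Finset V)) (D : Finset V) : Prop :=
  ∀ x : V, ∃ y ∈ D, HypVAdj E x y

/-- A partition of the full vertex set into `k` dominating sets. -/
def IsDomaticPartition {V : Type*} [Fintype V] [DecidableEq V] (E : Finset (Finset V))
    {k : ℕ} (C : Fin k → Finset V) : Prop :=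
  (∀ i j : Fin k, i ≠ j → Disjoint (C i) (C j)) ∧
  (Finset.univ.biUnion C = Finset.univ) ∧
  (∀ i, IsDominatingSet E (C i))

/-- A partition of the full vertex set into `k` total dominating sets. -/
def IsTotalDomaticPartition {V : Type*} [Fintype V] [DecidableEq V] (E : Finset (Finset V))
    {k : ℕ} (C : Fin k → Finset V) : Prop :=
  (∀ i j : Fin k, i ≠ j → Disjoint (C i) (C j)) ∧
  (Finset.univ.biUnion C = Finset.univ) ∧
  (∀ i, IsTotalDominatingSet E (C i))

/-- Two hyperedges are adjacent if they are distinct and share at least one vertex. -/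
def HypEAdj {V : Type*} [DecidableEq V] (e f : Finset V) : Prop :=
  e ≠ f ∧ (e ∩ f).Nonempty

/-- An edge-dominating set: a subset `F ⊆ E` such that every hyperedge not in `F`
is adjacent to some hyperedge of `F`. -/
def IsEdgeDominatingSet {V : Type*} [DecidableEq V] (E F : Finset (Finset V)) : Prop :=
  F ⊆ E ∧ ∀ e ∈ E, e ∉ F → ∃ f ∈ F, HypEAdj e f

/-- A total edge-dominating set: a subset `F ⊆ E` such that every hyperedge of `E`
is adjacent to some hyperedge of `F`. -/
def IsTotalEdgeDominatingSet {V : Type*} [DecidableEq V] (E F : Finset (Finset V)) : Prop :=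
  F ⊆ E ∧ ∀ e ∈ E, ∃ f ∈ F, HypEAdj e f

/-- A partition of the edge set `E` into `k` edge-dominating sets. -/
def IsEdgeDomaticPartition {V : Type*} [DecidableEq V] (E : Finset (Finset V))
    {k : ℕ} (C : Fin k → Finset (Finset V)) : Prop :=
  (∀ i j : Fin k, i ≠ j → Disjoint (C i) (C j)) ∧
  (Finset.univ.biUnion C = E) ∧
  (∀ i, IsEdgeDominatingSet E (C i))

/-- A partition of the edge set `E` into `k` total edge-dominating sets. -/
def IsTotalEdgeDomaticPartition {V : Type*} [DecidableEq V] (E : Finset (Finset V))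
    {k : ℕ} (C : Fin k → Finset (Finset V)) : Prop :=
  (∀ i j : Fin k, i ≠ j → Disjoint (C i) (C j)) ∧
  (Finset.univ.biUnion C = E) ∧
  (∀ i, IsTotalEdgeDominatingSet E (C i))

/-- Edge set of the complete `r`-uniform hypergraph on the vertex type `V`:
all `r`-element subsets of `V`. -/
def completeEdges (V : Type*) [Fintype V] [DecidableEq V] (r : ℕ) : Finset (Finset V) :=
  Finset.powersetCard r (Finset.univ : Finset V)

/-- Edge set of the complete bipartite `r`-uniform hypergraph with parts `X` and `Y`:
all `r`-element subsets of `X ∪ Y` meeting both `X` and `Y`. -/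
def bipEdges {V : Type*} [DecidableEq V] (X Y : Finset V) (r : ℕ) : Finset (Finset V) :=
  (Finset.powersetCard r (X ∪ Y)).filter fun e => (e ∩ X).Nonempty ∧ (e ∩ Y).Nonempty

theorem mem_bipEdges_iff {V : Type*} [DecidableEq V] {X Y e : Finset V} {r : ℕ} :
    e ∈ bipEdges X Y r ↔
      (e ⊆ X ∪ Y ∧ e.card = r) ∧ (e ∩ X).Nonempty ∧ (e ∩ Y).Nonempty := by
  simp [bipEdges, Finset.mem_powersetCard]

/-- A set of at most `|X|` vertices which meets `Y ⊆ Xᶜ` misses some vertex of `X`. -/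
theorem compl_inter_nonempty_of_card_le {V : Type*} [Fintype V] [DecidableEq V]
    {X Y e : Finset V} (hdisj : Disjoint X Y) (hcard : e.card ≤ X.card)
    (hY : (e ∩ Y).Nonempty) : (eᶜ ∩ X).Nonempty := by
  by_contra h
  rw [Finset.not_nonempty_iff_eq_empty] at h
  have hsub : X ⊆ e := by
    intro x hx
    by_contra hxe
    have : x ∈ eᶜ ∩ X := by simp [hx, hxe]
    simp [h] at this
  have heq := Finset.eq_of_subset_of_card_le hsub hcard
  subst heq
  exact hY.ne_empty (Finset.disjoint_iff_inter_eq_empty.mp hdisj)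

theorem compl_mem_bipEdges {V : Type*} [Fintype V] [DecidableEq V]
    {X Y e : Finset V} {r : ℕ} (hdisj : Disjoint X Y)
    (hunion : X ∪ Y = (Finset.univ : Finset V)) (hXr : X.card = r) (hYr : Y.card = r)
    (he : e ∈ bipEdges X Y r) : eᶜ ∈ bipEdges X Y r := by
  rw [mem_bipEdges_iff] at he ⊢
  obtain ⟨⟨-, hc⟩, hx, hy⟩ := he
  refine ⟨⟨by simp [hunion], ?_⟩,
    compl_inter_nonempty_of_card_le hdisj (by omega) hy,
    compl_inter_nonempty_of_card_le hdisj.symm (by omega) hx⟩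
  have := Finset.card_union_of_disjoint hdisj
  rw [hunion, Finset.card_univ] at this
  rw [Finset.card_compl]
  omega

theorem bipEdges_nonempty {V : Type*} [DecidableEq V] {X Y : Finset V} {r : ℕ}
    (hdisj : Disjoint X Y) (hY : Y.Nonempty) (hXr : X.card = r) (hr : 2 ≤ r) :
    (bipEdges X Y r).Nonempty := by
  obtain ⟨y, hy⟩ := hY
  obtain ⟨a, ha, b, hb, hab⟩ := Finset.one_lt_card.mp (by omega : 1 < X.card)
  have hyX : y ∉ X := fun h => Finset.disjoint_left.mp hdisj h hy
  refine ⟨insert y (X.erase a), mem_bipEdges_iff.mpr ⟨⟨?_, ?_⟩, ⟨b, ?_⟩, ⟨y, ?_⟩⟩⟩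
  · intro z hz
    simp only [Finset.mem_insert, Finset.mem_erase, Finset.mem_union] at hz ⊢
    rcases hz with rfl | ⟨-, hz⟩
    · exact Or.inr hy
    · exact Or.inl hz
  · rw [Finset.card_insert_of_notMem (by simp [hyX]), Finset.card_erase_of_mem ha]
    omega
  · simp [hb, hab.symm]
  · simp [hy]

/-- If a family of sets is closed under complement, half of its members contain `v`. -/
theorem card_eq_two_mul_card_filter_mem {V : Type*} [Fintype V] [DecidableEq V]
    {E : Finset (Finset V)} (hE : ∀ e ∈ E, eᶜ ∈ E) (v : V) :
    E.card = 2 * (E.filter fun e => v ∈ e).card := by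
  have h : (E.filter fun e => v ∈ e).card = (E.filter fun e => ¬ v ∈ e).card := by
    refine Finset.card_bij' (fun e _ => eᶜ) (fun e _ => eᶜ) ?_ ?_ ?_ ?_ <;>
      simp +contextual [hE]
  have := Finset.card_filter_add_card_filter_not (s := E) (fun e => v ∈ e)
  omega

/-- In a nonempty family closed under complement, every edge-dominating set has at least two
members, since no set is adjacent to its own complement. -/
theorem IsEdgeDominatingSet.two_le_card {V : Type*} [Fintype V] [DecidableEq V]
    {E F : Finset (Finset V)} (hV : Nonempty V) (hne : E.Nonempty)
    (hE : ∀ e ∈ E, eᶜ ∈ E) (hF : IsEdgeDominatingSet E F) : 2 ≤ F.card := by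
  have hFne : F.Nonempty := by
    obtain ⟨e, he⟩ := hne
    by_cases h : e ∈ F
    · exact ⟨e, h⟩
    · obtain ⟨f, hf, -⟩ := hF.2 e he h
      exact ⟨f, hf⟩
  obtain ⟨e, he⟩ := hFne
  by_contra hlt
  have huniq : ∀ f ∈ F, f = e := fun f hf =>
    Finset.card_le_one.mp (by omega) f hf e he
  have hnot : eᶜ ∉ F := fun h => compl_ne_self (huniq _ h)
  obtain ⟨f, hf, -, hadj⟩ := hF.2 _ (hE e (hF.1 he)) hnot
  rw [huniq f hf] at hadj
  obtain ⟨x, hx⟩ := hadj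
  simp at hx

/-- In a family of `r`-subsets of a `2r`-set, any pair of complementary members is
edge-dominating. -/
theorem isEdgeDominatingSet_pair_compl {V : Type*} [Fintype V] [DecidableEq V]
    {E : Finset (Finset V)} {r : ℕ} (hunif : ∀ e ∈ E, e.card = r)
    {e : Finset V} (he : e ∈ E) (hec : eᶜ ∈ E) :
    IsEdgeDominatingSet E {e, eᶜ} := by
  refine ⟨by simp [Finset.insert_subset_iff, he, hec], fun g hg hgn => ?_⟩
  simp only [Finset.mem_insert, Finset.mem_singleton, not_or] at hgn
  refine ⟨e, by simp, hgn.1, ?_⟩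
  by_contra h
  rw [Finset.not_nonempty_iff_eq_empty, ← Finset.disjoint_iff_inter_eq_empty] at h
  exact hgn.2 (Finset.eq_of_subset_of_card_le
    (le_compl_iff_disjoint_right.mpr h) (by rw [hunif g hg, hunif _ hec]))

/-- a complete bipartite `r`-uniform hypergraph with `|X| = |Y| = r`,
`r ≥ 2`, in which every vertex has degree `δ`, has edge-domatic number `δ`;
in particular `|E| = 2δ`. -/
theorem edge_domatic_number_bipartite_degree {V : Type*} [Fintype V] [DecidableEq V]
    {X Y : Finset V} {r δ : ℕ}
    (hdisj : Disjoint X Y) (hX : X.Nonempty) (hY : Y.Nonempty)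
    (hunion : X ∪ Y = (Finset.univ : Finset V))
    (hXr : X.card = r) (hYr : Y.card = r) (hr2 : 2 ≤ r)
    (hdeg : ∀ v : V, ((bipEdges X Y r).filter fun e => v ∈ e).card = δ) :
    IsGreatest {k : ℕ | ∃ C : Fin k → Finset (Finset V),
      IsEdgeDomaticPartition (bipEdges X Y r) C} δ ∧
    (bipEdges X Y r).card = 2 * δ := by
  have hcompl : ∀ e ∈ bipEdges X Y r, eᶜ ∈ bipEdges X Y r := fun e he =>
    compl_mem_bipEdges hdisj hunion hXr hYr he
  have hunif : ∀ e ∈ bipEdges X Y r, e.card = r := fun e he =>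
    (mem_bipEdges_iff.mp he).1.2
  obtain ⟨v, -⟩ := hX
  have hcard : (bipEdges X Y r).card = 2 * δ := by
    rw [card_eq_two_mul_card_filter_mem hcompl v, hdeg v]
  refine ⟨⟨?_, ?_⟩, hcard⟩
  · let φ := Finset.equivFinOfCardEq (hdeg v)
    have hmem : ∀ i, (φ.symm i : Finset V) ∈ bipEdges X Y r ∧ v ∈ (φ.symm i : Finset V) :=
      fun i => Finset.mem_filter.mp (φ.symm i).2
    refine ⟨fun i => {(φ.symm i : Finset V), (φ.symm i : Finset V)ᶜ}, ?_, ?_, fun i =>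
      isEdgeDominatingSet_pair_compl hunif (hmem i).1 (hcompl _ (hmem i).1)⟩
    · intro i j hij
      have hne : (φ.symm i : Finset V) ≠ φ.symm j := fun h =>
        hij (φ.symm.injective (Subtype.ext h))
      have hne' : (φ.symm i : Finset V) ≠ (φ.symm j : Finset V)ᶜ := fun h => by
        have := (hmem i).2
        rw [h, Finset.mem_compl] at this
        exact this (hmem j).2
      have hne'' : (φ.symm i : Finset V)ᶜ ≠ φ.symm j := fun h =>
        hne' (by rw [← h, compl_compl])
      simp only [Finset.disjoint_insert_left, Finset.disjoint_singleton_left,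
        Finset.mem_insert, Finset.mem_singleton, not_or]
      exact ⟨⟨hne, hne'⟩, hne'', fun h => hne (compl_injective h)⟩
    · ext e
      simp only [Finset.mem_biUnion, Finset.mem_univ, true_and, Finset.mem_insert,
        Finset.mem_singleton]
      constructor
      · rintro ⟨i, rfl | rfl⟩
        · exact (hmem i).1
        · exact hcompl _ (hmem i).1
      · intro he
        by_cases hv : v ∈ e
        · exact ⟨φ ⟨e, Finset.mem_filter.mpr ⟨he, hv⟩⟩, Or.inl (by simp)⟩
        · exact ⟨φ ⟨eᶜ, Finset.mem_filter.mpr ⟨hcompl e he, by simpa using hv⟩⟩,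
            Or.inr (by simp)⟩
  · rintro k ⟨C, hC, hCE, hCdom⟩
    have hne := bipEdges_nonempty hdisj hY hXr hr2
    have hsum : ∑ i, (C i).card = 2 * δ := by
      rw [← hcard, ← hCE, Finset.card_biUnion fun i _ j _ hij => hC i j hij]
    have hle : ∑ _i : Fin k, 2 ≤ ∑ i, (C i).card :=
      Finset.sum_le_sum fun i _ => (hCdom i).two_le_card ⟨v⟩ hne hcompl
    simp only [Finset.sum_const, Finset.card_univ, Fintype.card_fin, smul_eq_mul] at hle
    omega
end

section
/- Let H be the complete r-uniform hypergraph on a finite vertex set V with n vertices, where 1 ≤ r < n and r > ⌊n/2⌋. Then the total edge-domatic number of H equals ⌊C(n,r)/2⌋, i.e., ed_t(H) = ⌊C(n,r)/2⌋. -/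
open Finset

theorem IsTotalEdgeDominatingSet.two_le_card {V : Type*} [DecidableEq V]
    {E F : Finset (Finset V)} (h : IsTotalEdgeDominatingSet E F) (hE : E.Nonempty) :
    2 ≤ #F := by
  obtain ⟨e, he⟩ := hE
  obtain ⟨f, hf, -⟩ := h.2 e he
  obtain ⟨g, hg, hfg, -⟩ := h.2 f (h.1 hf)
  exact Finset.one_lt_card.2 ⟨f, hf, g, hg, hfg⟩

theorem IsTotalEdgeDomaticPartition.two_mul_le_card {V : Type*} [DecidableEq V]
    {E : Finset (Finset V)} {k : ℕ} {C : Fin k → Finset (Finset V)}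
    (h : IsTotalEdgeDomaticPartition E C) (hE : E.Nonempty) : 2 * k ≤ #E := by
  obtain ⟨hd, hu, ht⟩ := h
  rw [← hu, Finset.card_biUnion fun i _ j _ hij => hd i j hij]
  calc 2 * k = ∑ _i : Fin k, 2 := by simp [mul_comm]
    _ ≤ ∑ i, #(C i) := Finset.sum_le_sum fun i _ => (ht i).two_le_card hE

/-- A finite set can be split into `k` classes of at least two elements each as soon as
it has at least `2 * k` elements and `k` is positive. -/
theorem exists_partition_one_lt_card {α : Type*} [DecidableEq α] (E : Finset α) {k : ℕ}
    (hk : 0 < k) (hE : 2 * k ≤ #E) :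
    ∃ C : Fin k → Finset α, (∀ i j, i ≠ j → Disjoint (C i) (C j)) ∧
      Finset.univ.biUnion C = E ∧ ∀ i, 1 < #(C i) := by
  let g : E → Fin k := fun x => ⟨E.equivFin x % k, Nat.mod_lt _ hk⟩
  refine ⟨fun i => (Finset.univ.filter fun x => g x = i).map (Function.Embedding.subtype _),
    fun i j hij => ?_, ?_, fun i => ?_⟩
  · rw [Finset.disjoint_map]
    exact Finset.disjoint_filter.2 fun x _ hi hj => hij (hi.symm.trans hj)
  · ext x
    simp
  · have hi := i.2
    rw [Finset.card_map, Finset.one_lt_card]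
    refine ⟨E.equivFin.symm ⟨i, by omega⟩, ?_, E.equivFin.symm ⟨i + k, by omega⟩, ?_, ?_⟩
    · simp [g, Fin.ext_iff, Nat.mod_eq_of_lt hi]
    · simp [g, Fin.ext_iff, Nat.mod_eq_of_lt hi]
    · rw [Ne, E.equivFin.symm.injective.eq_iff, Fin.mk.injEq]
      omega

theorem inter_nonempty_of_mem_completeEdges {V : Type*} [Fintype V] [DecidableEq V] {r : ℕ}
    (hr : Fintype.card V < 2 * r) {e f : Finset V} (he : e ∈ completeEdges V r)
    (hf : f ∈ completeEdges V r) : (e ∩ f).Nonempty := by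
  rw [completeEdges, Finset.mem_powersetCard_univ] at he hf
  rw [← Finset.card_pos]
  have h₁ := Finset.card_union_add_card_inter e f
  have h₂ := Finset.card_le_univ (e ∪ f)
  omega

theorem isTotalEdgeDominatingSet_completeEdges {V : Type*} [Fintype V] [DecidableEq V] {r : ℕ}
    (hr : Fintype.card V < 2 * r) {F : Finset (Finset V)} (hF : F ⊆ completeEdges V r)
    (hF₂ : 1 < #F) : IsTotalEdgeDominatingSet (completeEdges V r) F := by
  refine ⟨hF, fun e he => ?_⟩
  obtain ⟨f, hf, hfe⟩ := Finset.exists_mem_ne hF₂ e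
  exact ⟨f, hf, hfe.symm, inter_nonempty_of_mem_completeEdges hr he (hF hf)⟩

/-- the complete `r`-uniform hypergraph on `n` vertices with `1 ≤ r < n`
and `r > ⌊n/2⌋` has total edge-domatic number `⌊C(n,r)/2⌋`. -/
theorem total_edge_domatic_number_complete {V : Type*} [Fintype V] [DecidableEq V]
    {r n : ℕ} (hn : Fintype.card V = n) (hr1 : 1 ≤ r) (hrn : r < n) (hr : n / 2 < r) :
    IsGreatest {k : ℕ | ∃ C : Fin k → Finset (Finset V),
      IsTotalEdgeDomaticPartition (completeEdges V r) C} (n.choose r / 2) := by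
  have hcard : #(completeEdges V r) = n.choose r := by
    rw [completeEdges, Finset.card_powersetCard, Finset.card_univ, hn]
  have hchoose : 2 ≤ n.choose r := by
    obtain ⟨m, rfl⟩ := Nat.exists_eq_succ_of_ne_zero (by omega : n ≠ 0)
    obtain ⟨s, rfl⟩ := Nat.exists_eq_succ_of_ne_zero (by omega : r ≠ 0)
    have h₁ := Nat.choose_pos (by omega : s ≤ m)
    have h₂ := Nat.choose_pos (by omega : s + 1 ≤ m)
    rw [Nat.succ_eq_add_one, Nat.succ_eq_add_one, Nat.choose_succ_succ]
    simp only [Nat.succ_eq_add_one]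
    omega
  constructor
  · obtain ⟨C, hd, hu, hC⟩ := exists_partition_one_lt_card (completeEdges V r)
      (by omega : 0 < n.choose r / 2) (by omega)
    exact ⟨C, hd, hu, fun i => isTotalEdgeDominatingSet_completeEdges (by omega)
      (hu ▸ Finset.subset_biUnion_of_mem C (Finset.mem_univ i)) (hC i)⟩
  · rintro k ⟨C, hC⟩
    have := hC.two_mul_le_card (Finset.card_pos.1 (by omega))
    omega
end
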